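/- Let S be an S-tree. Then Core(S) = V(S) \ Supp(S); that is, the core of S is exactly the set of non-supported vertices of S. -/

import Mathlib

open scoped Classical

namespace NullDecomp

variable {V : Type*}

/-- The null space of the real adjacency matrix of a graph. -/
def nullSpace [Fintype V] (G : SimpleGraph V) : Set (V → ℝ) :=
  {x | Matrix.mulVec (G.adjMatrix ℝ) x = 0}

/-- The support of the null space: vertices with a nonzero entry in some null vector. -/
def supportSet [Fintype V] (G : SimpleGraph V) : Set V :=
  {v | ∃ x ∈ nullSpace G, x v ≠ 0}

/-- The (open) neighborhood of a set of vertices. -/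
def nbhdSet (G : SimpleGraph V) (A : Set V) : Set V :=
  {v | ∃ u ∈ A, G.Adj u v}

/-- The closed neighborhood of a set of vertices. -/
def closedNbhd (G : SimpleGraph V) (A : Set V) : Set V :=
  A ∪ nbhdSet G A

/-- The core of a graph: the neighborhood of the support of the null space. -/
def coreSet [Fintype V] (G : SimpleGraph V) : Set V :=
  nbhdSet G (supportSet G)

/-- A tree is an S-tree if the closed neighborhood of its support is everything. -/
def IsSTree [Fintype V] (G : SimpleGraph V) : Prop :=
  G.IsTree ∧ closedNbhd G (supportSet G) = Set.univ

/-- A matching: a set of edges of `G`, pairwise disjoint. -/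
def IsMatchingSet (G : SimpleGraph V) (M : Finset (Sym2 V)) : Prop :=
  (↑M : Set (Sym2 V)) ⊆ G.edgeSet ∧
    ∀ e ∈ M, ∀ f ∈ M, e ≠ f → ∀ v : V, v ∈ e → v ∉ f

/-- A maximum matching. -/
def IsMaxMatching [Fintype V] (G : SimpleGraph V) (M : Finset (Sym2 V)) : Prop :=
  IsMatchingSet G M ∧ ∀ M' : Finset (Sym2 V), IsMatchingSet G M' → M'.card ≤ M.card

/-- The matching number. -/
noncomputable def matchingNumber [Fintype V] (G : SimpleGraph V) : ℕ :=
  sSup {n | ∃ M : Finset (Sym2 V), IsMatchingSet G M ∧ M.card = n}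

/-- An independent set of vertices. -/
def IsIndep (G : SimpleGraph V) (A : Set V) : Prop :=
  ∀ u ∈ A, ∀ w ∈ A, ¬ G.Adj u w

/-- The independence number. -/
noncomputable def indepNumber [Fintype V] (G : SimpleGraph V) : ℕ :=
  sSup {n | ∃ A : Set V, IsIndep G A ∧ A.ncard = n}

/-- A vertex cover. -/
def IsVertexCover (G : SimpleGraph V) (Cs : Set V) : Prop :=
  ∀ e ∈ G.edgeSet, ∃ v ∈ Cs, v ∈ e

/-- The vertex cover number. -/
noncomputable def coverNumber [Fintype V] (G : SimpleGraph V) : ℕ :=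
  sInf {n | ∃ Cs : Set V, IsVertexCover G Cs ∧ Cs.ncard = n}

/-- The nullity of a graph: dimension of the kernel of its adjacency matrix. -/
noncomputable def nullity [Fintype V] (G : SimpleGraph V) : ℕ :=
  Module.finrank ℝ (LinearMap.ker (Matrix.mulVecLin (G.adjMatrix ℝ)))

/-- The number of maximum matchings of a graph. -/
noncomputable def numMaxMatchings [Fintype V] (G : SimpleGraph V) : ℕ :=
  Set.ncard {M : Finset (Sym2 V) | IsMaxMatching G M}

/-- `C` is (the vertex set of) a connected component of the subgraph of `T`
induced by the closed neighborhood of the support of `T`. -/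
def IsSComponent [Fintype V] (T : SimpleGraph V) (C : Set V) : Prop :=
  ∃ c : (T.induce (closedNbhd T (supportSet T))).ConnectedComponent,
    C = Subtype.val '' c.supp

/-- `C` is (the vertex set of) a connected component of the subgraph of `T`
induced by the complement of the closed neighborhood of the support of `T`. -/
def IsNComponent [Fintype V] (T : SimpleGraph V) (C : Set V) : Prop :=
  ∃ c : (T.induce ((closedNbhd T (supportSet T))ᶜ)).ConnectedComponent,
    C = Subtype.val '' c.supp

/-- The zero-extension to `ℝ^V` of the null space of the subgraph of `T` induced by `C`:
vectors vanishing outside `C` whose restriction to `C` is a null vector of `T.induce C`. -/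
noncomputable def extNull [Fintype V] (T : SimpleGraph V) (C : Set V) : Submodule ℝ (V → ℝ) :=
  LinearMap.ker ((Matrix.mulVecLin ((T.induce C).adjMatrix ℝ)).comp
      (LinearMap.funLeft ℝ ℝ (Subtype.val : ↥C → V))) ⊓
  LinearMap.ker (LinearMap.funLeft ℝ ℝ (Subtype.val : ↥(Cᶜ) → V))

theorem mem_nullSpace_iff [Fintype V] {G : SimpleGraph V} {x : V → ℝ} :
    x ∈ nullSpace G ↔ ∀ p, ∑ q, (if G.Adj p q then x q else 0) = 0 := by
  simp only [nullSpace, Set.mem_ofPred_eq, funext_iff, Matrix.mulVec, dotProduct,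
    SimpleGraph.adjMatrix_apply, ite_mul, one_mul, zero_mul, Pi.zero_apply]

/-- Restricting a null vector to a color class of a proper 2-coloring gives a null vector. -/
theorem indicator_colorClass_mem_nullSpace [Fintype V] {G : SimpleGraph V}
    (c : G.Coloring (Fin 2)) (i : Fin 2) {x : V → ℝ} (hx : x ∈ nullSpace G) :
    (fun v ↦ if c v = i then x v else 0) ∈ nullSpace G := by
  rw [mem_nullSpace_iff] at hx ⊢
  intro p
  by_cases hp : c p = i
  · refine Finset.sum_eq_zero fun q _ ↦ ?_
    split_ifs with h hq
    · exact absurd (hp.trans hq.symm) (c.valid h)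
    · rfl
    · rfl
  · refine (Finset.sum_congr rfl fun q _ ↦ ?_).trans (hx p)
    split_ifs with h hq
    · rfl
    · have := c.valid h
      omega
    · rfl

/-- The values of two null vectors at the ends of a bridge are proportional. -/
theorem mul_eq_mul_of_isBridge [Fintype V] {G : SimpleGraph V} {u v : V} (h : G.Adj u v)
    (hb : G.IsBridge s(u, v)) {x z : V → ℝ} (hx : x ∈ nullSpace G) (hz : z ∈ nullSpace G) :
    x u * z v = z u * x v := by
  rw [mem_nullSpace_iff] at hx hz
  rw [SimpleGraph.isBridge_iff] at hb
  set H := G.deleteEdges {s(u, v)} with hH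
  have key : ∀ p q, H.Reachable u p → ¬ H.Reachable u q → G.Adj p q → p = u ∧ q = v := by
    intro p q hp hq hpq
    by_cases he : s(p, q) = s(u, v)
    · rcases Sym2.eq_iff.mp he with h' | ⟨rfl, rfl⟩
      · exact h'
      · exact absurd hp hb
    · refine absurd (hp.trans (SimpleGraph.Adj.reachable ?_)) hq
      rw [hH, SimpleGraph.deleteEdges_adj]
      exact ⟨hpq, he⟩
  let f : V → V → ℝ := fun p q ↦
    if H.Reachable u p ∧ G.Adj p q then x p * z q - z p * x q else 0
  let g : V → V → ℝ := fun p q ↦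
    if H.Reachable u p ∧ H.Reachable u q ∧ G.Adj p q then x p * z q - z p * x q else 0
  have hf : ∑ p, ∑ q, f p q = 0 := by
    refine Finset.sum_eq_zero fun p _ ↦ ?_
    by_cases hp : H.Reachable u p
    · have : ∀ q, f p q = x p * (if G.Adj p q then z q else 0)
          - z p * (if G.Adj p q then x q else 0) := by
        intro q
        simp only [f, hp, true_and]
        split_ifs <;> ring
      simp only [this, Finset.sum_sub_distrib, ← Finset.mul_sum, hx, hz, mul_zero, sub_zero]
    · simp [f, hp]
  have hg : ∑ p, ∑ q, g p q = 0 := by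
    have hanti : ∀ p q, g p q = - g q p := by
      intro p q
      simp only [g, G.adj_comm q p]
      split_ifs <;> first | (exfalso; tauto) | ring
    have : ∑ p, ∑ q, g p q = - ∑ p, ∑ q, g p q := by
      conv_lhs => rw [Finset.sum_comm]
      simp only [← Finset.sum_neg_distrib]
      exact Finset.sum_congr rfl fun p _ ↦ Finset.sum_congr rfl fun q _ ↦ hanti q p
    linarith
  have hfg : ∀ p q, f p q - g p q =
      if p = u then (if q = v then x u * z v - z u * x v else 0) else 0 := by
    intro p q
    by_cases hpq : p = u ∧ q = v
    · obtain ⟨rfl, rfl⟩ := hpq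
      simp [f, g, h, hb]
    · have hz : f p q = g p q := by
        by_cases hp : H.Reachable u p <;> by_cases hq : H.Reachable u q <;>
          by_cases ha : G.Adj p q <;> simp [f, g, hp, hq, ha]
        exact absurd (key p q hp hq ha) hpq
      rw [hz, sub_self]
      split_ifs <;> first | rfl | tauto
  have : ∑ p, ∑ q, (f p q - g p q) = x u * z v - z u * x v := by
    simp [hfg]
  simp only [Finset.sum_sub_distrib, hf, hg] at this
  linarith

/-- The support of the null space of an acyclic graph is independent. -/
theorem isIndep_supportSet [Fintype V] {G : SimpleGraph V} (hG : G.IsAcyclic) :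
    IsIndep G (supportSet G) := by
  rintro u ⟨x, hx, hxu⟩ v ⟨z, hz, hzv⟩ h
  obtain ⟨c⟩ := hG.colorable_two
  have := mul_eq_mul_of_isBridge h (SimpleGraph.isAcyclic_iff_forall_adj_isBridge.mp hG h)
    (indicator_colorClass_mem_nullSpace c (c u) hx)
    (indicator_colorClass_mem_nullSpace c (c v) hz)
  simp [c.valid h, (c.valid h).symm, hxu, hzv] at this

/-- In an S-tree, the core is precisely the set of non-supported vertices. -/
theorem stmt2 [Fintype V] (S : SimpleGraph V) (hS : IsSTree S) :
    coreSet S = Set.univ \ supportSet S := by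
  ext v
  simp only [Set.mem_sdiff, Set.mem_univ, true_and]
  constructor
  · rintro ⟨u, hu, huv⟩ hv
    exact isIndep_supportSet hS.1.isAcyclic u hu v hv huv
  · intro hv
    have : v ∈ closedNbhd S (supportSet S) := hS.2 ▸ Set.mem_univ v
    exact this.resolve_left hv

end NullDecomp
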